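/- Let F₂ be the free group on generators a and b, S ⊆ F₂ the set of elements whose reduced word is empty or ends in b or b⁻¹, H = ℓ²(S). For θ, θ′ ∈ ℂ with |θ| = |θ′| = 1 and θ ≠ θ′, let U_θ and U_{θ′} be group homomorphisms from F₂ to the unitary operators on H satisfying the defining relations with parameters θ and θ′ respectively (U(a)δ_e = θ·δ_e resp. θ′·δ_e, U(a)δ_g = δ_{a·g} for g ∈ S ∖ {e}, U(b)δ_g = δ_{b·g} for g ∈ S). Then U_θ and U_{θ′} are not unitarily equivalent: there is no unitary operator W on H with W ∘ U_θ(g) = U_{θ′}(g) ∘ W for all g ∈ F₂. -/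

import Mathlib

open scoped ENNReal

/-- The free group on two generators. -/
abbrev F2 : Type := FreeGroup (Fin 2)

/-- The generator `a` of `F₂`. -/
def genA : F2 := FreeGroup.of 0

/-- The generator `b` of `F₂`. -/
def genB : F2 := FreeGroup.of 1

/-- `S = G_b′`: the set of elements of `F₂` whose reduced word is empty
or ends in `b` or `b⁻¹`. -/
def SetS : Set F2 := {g : F2 | ∀ l ∈ g.toWord.getLast?, l.1 = (1 : Fin 2)}

/-- `H = ℓ²(S)`. -/
noncomputable abbrev HS : Type := lp (fun _ : SetS => ℂ) 2

/-- `δ_g`, the indicator basis vector of `g ∈ S` in `ℓ²(S)`. -/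
noncomputable def deltaS (g : SetS) : HS :=
  letI : DecidableEq ↥SetS := Classical.decEq _
  lp.single 2 g 1

theorem SetS.genA_mul_mem {g : F2} (hg : g ∈ SetS) (hg1 : g ≠ 1) :
    genA * g ∈ SetS ∧ genA * g ≠ 1 := by
  have hw : (genA * g).toWord = FreeGroup.reduce ((0, true) :: g.toWord) := by
    simp [genA, FreeGroup.toWord_mul]
  have hg1' : g.toWord ≠ [] := by simpa using hg1
  rw [FreeGroup.reduce.cons, FreeGroup.reduce_toWord] at hw
  simp only [SetS, Set.mem_ofPred_eq] at hg ⊢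
  rw [ne_eq, ← FreeGroup.toWord_eq_nil_iff, hw]
  rcases hL : g.toWord with _ | ⟨hd, _ | ⟨x, tl⟩⟩
  · exact absurd hL hg1'
  · rw [hL] at hg
    have hd1 : hd.1 = 1 := by simpa using hg
    simp [hd1]
  · rw [hL] at hg
    dsimp only
    split_ifs <;> simpa [List.getLast?_cons_cons] using hg

theorem SetS.genA_pow_mul_mem {g : F2} (hg : g ∈ SetS) (hg1 : g ≠ 1) (n : ℕ) :
    genA ^ n * g ∈ SetS ∧ genA ^ n * g ≠ 1 := by
  induction n with
  | zero => simpa using ⟨hg, hg1⟩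
  | succ n ih =>
    rw [pow_succ', mul_assoc]
    exact SetS.genA_mul_mem ih.1 ih.2

theorem genA_pow_injective : Function.Injective fun n : ℕ => genA ^ n := by
  intro m n h
  simpa [genA, FreeGroup.toWord_of_pow] using congrArg (fun g : F2 => g.toWord.length) h

theorem inner_deltaS (g : SetS) (v : HS) : inner ℂ (deltaS g) v = v g := by
  classical
  simp [deltaS, lp.inner_single_left]

theorem deltaS_ne_zero (g : SetS) : deltaS g ≠ 0 := by
  classical
  intro h
  simpa [deltaS] using congrArg (fun v : HS => v g) h

/-- A square-summable function vanishes at any index lying on an infinite sequence of distinct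
indices along which its modulus is constant. -/
theorem lp.apply_eq_zero_of_norm_eq_on_seq {ι : Type*} (v : lp (fun _ : ι => ℂ) 2) {i : ι}
    {f : ℕ → ι} (hf : Function.Injective f) (hv : ∀ n, ‖v (f n)‖ = ‖v i‖) : v i = 0 := by
  have hs := ((lp.memℓp v).summable (by norm_num)).comp_injective hf
  simp only [Function.comp_def, hv, summable_const_iff] at hs
  simpa using hs

/-- If an isometry acts on the `δ_g`, `g ≠ e`, as left multiplication by `a`, then its
eigenvectors for unimodular eigenvalues vanish off `e`. -/
theorem apply_eq_zero_of_eigenvector {T : HS ≃ₗᵢ[ℂ] HS} {θ : ℂ} (hθ : ‖θ‖ = 1)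
    (hT : ∀ g h : SetS, (g : F2) ≠ 1 → (h : F2) = genA * g → T (deltaS g) = deltaS h)
    {v : HS} (hv : T v = θ • v) {g : SetS} (hg : (g : F2) ≠ 1) : v g = 0 := by
  have step : ∀ g h : SetS, (g : F2) ≠ 1 → (h : F2) = genA * g → ‖v h‖ = ‖v g‖ := by
    intro g h hg hh
    have key := T.inner_map_map (deltaS g) v
    rw [hT g h hg hh, hv, inner_smul_right, inner_deltaS, inner_deltaS] at key
    rw [← key, norm_mul, hθ, one_mul]
  have hmem := SetS.genA_pow_mul_mem g.2 hg
  refine lp.apply_eq_zero_of_norm_eq_on_seq v (f := fun n => ⟨genA ^ n * g, (hmem n).1⟩) ?_ ?_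
  · intro m n h
    exact genA_pow_injective (mul_right_cancel (Subtype.ext_iff.mp h))
  · intro n
    induction n with
    | zero => simp
    | succ n ih =>
      rw [← ih]
      exact step _ _ (hmem n).2 (by simp only [pow_succ', mul_assoc])

/-- For `θ ≠ θ′` on the unit circle, Yoshizawa's representations `U_θ` and `U_{θ′}`
of `F₂` on `ℓ²(S)` are not unitarily equivalent. -/
theorem yoshizawa_representations_inequivalent
    (θ θ' : ℂ) (hθ : ‖θ‖ = 1) (hθ' : ‖θ'‖ = 1) (hne : θ ≠ θ')
    (U U' : F2 →* (HS ≃ₗᵢ[ℂ] HS))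
    (hUa1 : ∀ g : SetS, (g : F2) = 1 → U genA (deltaS g) = θ • deltaS g)
    (hUa : ∀ g h : SetS, (g : F2) ≠ 1 → (h : F2) = genA * g →
      U genA (deltaS g) = deltaS h)
    (hUb : ∀ g h : SetS, (h : F2) = genB * g → U genB (deltaS g) = deltaS h)
    (hU'a1 : ∀ g : SetS, (g : F2) = 1 → U' genA (deltaS g) = θ' • deltaS g)
    (hU'a : ∀ g h : SetS, (g : F2) ≠ 1 → (h : F2) = genA * g →
      U' genA (deltaS g) = deltaS h)
    (hU'b : ∀ g h : SetS, (h : F2) = genB * g → U' genB (deltaS g) = deltaS h) :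
    ¬ ∃ W : HS ≃ₗᵢ[ℂ] HS, ∀ (g : F2) (v : HS), W (U g v) = U' g (W v) := by
  rintro ⟨W, hW⟩
  let e : SetS := ⟨1, by simp [SetS]⟩
  have hv : U' genA (W (deltaS e)) = θ • W (deltaS e) := by
    rw [← hW, hUa1 e rfl, map_smul]
  have he : W (deltaS e) e = 0 := by
    have key := (U' genA).inner_map_map (deltaS e) (W (deltaS e))
    rw [hU'a1 e rfl, hv, inner_smul_left, inner_smul_right, inner_deltaS] at key
    have hconj : θ' * (starRingEnd ℂ) θ' = 1 := by
      rw [Complex.mul_conj, Complex.normSq_eq_norm_sq, hθ']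
      norm_num
    have : (θ - θ') * W (deltaS e) e = 0 := by
      linear_combination θ' * key - θ * W (deltaS e) e * hconj
    exact (mul_eq_zero.mp this).resolve_left (sub_ne_zero.mpr hne)
  refine deltaS_ne_zero e ((map_eq_zero_iff W W.injective).mp ?_)
  ext g
  by_cases hg : (g : F2) = 1
  · rw [show g = e from Subtype.ext hg, he]
    rfl
  · exact apply_eq_zero_of_eigenvector hθ hU'a hv hg
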